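/- Let p > 0 be even and let π = D*₄ₚ be the binary dihedral group of order 4p. Then Σ |C(g)|·|C(h)| / |C(g³)|, the sum taken over all pairs of conjugacy classes (C(g), C(h)) of π such that g³ and h³ are conjugate, equals 8p if p ≡ 0 mod 3 and equals 4p if p ≢ 0 mod 3. -/

import Mathlib

/-!
Statement 16: for the binary dihedral group `D*₄ₚ = QuaternionGroup p` with `p` even, the sum
of `|C(g)|·|C(h)|/|C(g³)|` over all pairs of conjugacy classes whose cubes are conjugate
equals `8p` if `3 ∣ p` and `4p` otherwise.
-/

open scoped BigOperators

/-- The map on conjugacy classes induced by `g ↦ g ^ n`. -/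
noncomputable def conjClassesPow {G : Type*} [Group G] (n : ℕ) :
    ConjClasses G → ConjClasses G :=
  Quotient.lift (fun g => ConjClasses.mk (g ^ n)) (by
    intro a b hab
    obtain ⟨c, hc⟩ := isConj_iff.mp hab
    exact ConjClasses.mk_eq_mk_iff_isConj.mpr (isConj_iff.mpr ⟨c, by rw [← hc, conj_pow]⟩))

section FiniteGroup

open Finset

variable {G : Type*} [Group G]

theorem conjClassesPow_mk (n : ℕ) (g : G) :
    conjClassesPow n (ConjClasses.mk g) = ConjClasses.mk (g ^ n) := rfl

variable [Fintype G]

open scoped Classical in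
theorem ConjClasses.natCard_carrier (C : ConjClasses G) :
    Nat.card C.carrier = #{g : G | ConjClasses.mk g = C} := by
  simp [Fintype.card_subtype, Nat.card_eq_fintype_card, ConjClasses.mem_carrier_iff_mk_eq]

open scoped Classical in
theorem ConjClasses.sum_natCard_carrier_mul [Fintype (ConjClasses G)] (f : ConjClasses G → ℚ) :
    ∑ C, (Nat.card C.carrier : ℚ) * f C = ∑ g : G, f (ConjClasses.mk g) := by
  rw [← Finset.sum_fiberwise' univ ConjClasses.mk f]
  simp only [ConjClasses.natCard_carrier, sum_const, nsmul_eq_mul]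

open scoped Classical in
theorem card_filter_pow_eq_of_isConj (n : ℕ) {d e : G} (h : IsConj d e) :
    #{g : G | g ^ n = d} = #{g : G | g ^ n = e} := by
  obtain ⟨c, rfl⟩ := isConj_iff.mp h
  refine Finset.card_equiv (MulAut.conj c).toEquiv fun g => ?_
  simp [conj_pow]

open scoped Classical in
theorem card_filter_mk_pow_eq (n : ℕ) (d : G) :
    #{g : G | ConjClasses.mk (g ^ n) = ConjClasses.mk d} =
      Nat.card (ConjClasses.mk d).carrier * #{g : G | g ^ n = d} := by
  rw [ConjClasses.natCard_carrier, Finset.card_eq_sum_card_fiberwise (f := fun g : G => g ^ n)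
    (t := {e : G | ConjClasses.mk e = ConjClasses.mk d}) (fun g hg => by simpa using hg),
    ← smul_eq_mul]
  refine Finset.sum_eq_card_nsmul fun e he => ?_
  rw [mem_filter_univ] at he
  rw [← card_filter_pow_eq_of_isConj n (ConjClasses.mk_eq_mk_iff_isConj.mp he), filter_filter]
  congr 1
  ext g
  simp only [mem_filter_univ, and_iff_right_iff_imp]
  rintro rfl
  exact he

open scoped Classical in
theorem finsum_conjClassesPow_pairs (n : ℕ) :
    (∑ᶠ q ∈ {q : ConjClasses G × ConjClasses G | conjClassesPow n q.1 = conjClassesPow n q.2},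
      (Nat.card q.1.carrier : ℚ) * (Nat.card q.2.carrier : ℚ)
        / (Nat.card (conjClassesPow n q.1).carrier : ℚ)) =
      ∑ g : G, (#{h : G | h ^ n = g ^ n} : ℚ) := by
  have := Fintype.ofFinite (ConjClasses G)
  have hsum : ∀ C : ConjClasses G,
      (∑ D, if conjClassesPow n C = conjClassesPow n D then
        (Nat.card C.carrier : ℚ) * (Nat.card D.carrier : ℚ)
          / (Nat.card (conjClassesPow n C).carrier : ℚ) else 0) =
      (Nat.card C.carrier : ℚ) * ∑ h : G,
        if conjClassesPow n C = conjClassesPow n (ConjClasses.mk h) then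
          (Nat.card (conjClassesPow n C).carrier : ℚ)⁻¹ else 0 := by
    intro C
    rw [← ConjClasses.sum_natCard_carrier_mul (fun D => if conjClassesPow n C =
      conjClassesPow n D then (Nat.card (conjClassesPow n C).carrier : ℚ)⁻¹ else 0), mul_sum]
    refine Finset.sum_congr rfl fun D _ => ?_
    split_ifs <;> ring
  rw [finsum_mem_eq_finite_toFinset_sum _ (Set.toFinite _)]
  simp only [Set.Finite.toFinset_ofPred, sum_filter, Fintype.sum_prod_type, hsum]
  rw [ConjClasses.sum_natCard_carrier_mul (fun C => ∑ h : G,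
    if conjClassesPow n C = conjClassesPow n (ConjClasses.mk h) then
      (Nat.card (conjClassesPow n C).carrier : ℚ)⁻¹ else 0)]
  refine Finset.sum_congr rfl fun g _ => ?_
  have hpos : (Nat.card (ConjClasses.mk (g ^ n)).carrier : ℚ) ≠ 0 := by
    have : Nonempty (ConjClasses.mk (g ^ n)).carrier := ⟨⟨_, ConjClasses.mem_carrier_mk⟩⟩
    exact_mod_cast Nat.card_pos.ne'
  have hfilter : ({h : G | conjClassesPow n (ConjClasses.mk g) =
      conjClassesPow n (ConjClasses.mk h)} : Finset G) =
      ({h : G | ConjClasses.mk (h ^ n) = ConjClasses.mk (g ^ n)} : Finset G) :=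
    filter_congr fun h _ => eq_comm
  rw [← sum_filter, sum_const, hfilter, card_filter_mk_pow_eq, nsmul_eq_mul, conjClassesPow_mk]
  push_cast
  field_simp

end FiniteGroup

open Finset in
theorem ZMod.card_filter_natCast_mul_eq {m d : ℕ} [NeZero m] (hd : d ∣ m) (i : ZMod m) :
    #{j : ZMod m | (d : ZMod m) * j = d * i} = d := by
  have hker := IsAddCyclic.card_nsmulAddMonoidHom_ker (G := ZMod m) d
  rw [Nat.card_zmod, Nat.gcd_eq_right hd] at hker
  refine Eq.trans ?_ hker
  rw [Nat.card_eq_fintype_card, Fintype.card_subtype]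
  refine Finset.card_equiv (Equiv.subRight i) fun j => ?_
  simp [AddMonoidHom.mem_ker, mul_sub, sub_eq_zero]

namespace QuaternionGroup

open Finset

/-- The elements of `QuaternionGroup n` as two copies of `ZMod (2 * n)`. -/
def sumEquiv (n : ℕ) : ZMod (2 * n) ⊕ ZMod (2 * n) ≃ QuaternionGroup n where
  toFun := Sum.elim a xa
  invFun
    | a i => Sum.inl i
    | xa i => Sum.inr i
  left_inv := by rintro (i | i) <;> rfl
  right_inv := by rintro (i | i) <;> rfl

variable {n : ℕ}

theorem a_pow_three (i : ZMod (2 * n)) : a i ^ 3 = a (3 * i) := by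
  simp only [pow_succ, pow_zero, one_mul, a_mul_a]
  ring_nf

theorem xa_pow_three (i : ZMod (2 * n)) : xa i ^ 3 = xa ((n : ZMod (2 * n)) + i) := by
  rw [pow_succ, xa_sq, a_mul_xa]
  have : (2 * n : ZMod (2 * n)) = 0 := by exact_mod_cast ZMod.natCast_self (2 * n)
  congr 1
  linear_combination -this

variable [NeZero n]

theorem card_filter_pow_three_eq_a (hn : 3 ∣ n) (i : ZMod (2 * n)) :
    #{h : QuaternionGroup n | h ^ 3 = a i ^ 3} = 3 := by
  refine Eq.trans ?_ (ZMod.card_filter_natCast_mul_eq (hn.mul_left 2) i)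
  symm
  refine Finset.card_bij (fun j _ => a j) ?_ ?_ ?_
  · simp +contextual [a_pow_three]
  · simp
  · rintro (j | j) <;> simp [a_pow_three, xa_pow_three]

theorem card_filter_pow_three_eq_xa (i : ZMod (2 * n)) :
    #{h : QuaternionGroup n | h ^ 3 = xa i ^ 3} = 1 := by
  rw [Finset.card_eq_one]
  refine ⟨xa i, ?_⟩
  ext (j | j) <;> simp [a_pow_three, xa_pow_three]

theorem sum_card_filter_pow_three_of_dvd (hn : 3 ∣ n) :
    ∑ g : QuaternionGroup n, #{h : QuaternionGroup n | h ^ 3 = g ^ 3} = 8 * n := by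
  rw [← (sumEquiv n).sum_comp, Fintype.sum_sum_type]
  refine (congrArg₂ (· + ·) (sum_congr rfl fun i _ => card_filter_pow_three_eq_a hn i)
    (sum_congr rfl fun i _ => card_filter_pow_three_eq_xa i)).trans ?_
  simp only [sum_const, card_univ, ZMod.card, smul_eq_mul]
  ring

theorem sum_card_filter_pow_three_of_not_dvd (hn : ¬ 3 ∣ n) :
    ∑ g : QuaternionGroup n, #{h : QuaternionGroup n | h ^ 3 = g ^ 3} = 4 * n := by
  have hcop : (Nat.card (QuaternionGroup n)).Coprime 3 := by
    rw [Nat.card_eq_fintype_card, card, Nat.coprime_comm, Nat.prime_three.coprime_iff_not_dvd]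
    omega
  have hinj (g h : QuaternionGroup n) : h ^ 3 = g ^ 3 ↔ h = g := hcop.pow_left_bijective.1.eq_iff
  have hone (g : QuaternionGroup n) : #{h : QuaternionGroup n | h ^ 3 = g ^ 3} = 1 :=
    card_eq_one.mpr ⟨g, by ext h; simp [hinj]⟩
  simp only [hone, sum_const, card_univ, card, smul_eq_mul, mul_one]

end QuaternionGroup

/-- the cube-class pair sum for `D*₄ₚ`, `p > 0` even. -/
theorem quaternionGroup_even_cube_pair_sum (p : ℕ) (hp : 0 < p) (hpe : Even p) :
    (3 ∣ p →
      (∑ᶠ q ∈ {q : ConjClasses (QuaternionGroup p) × ConjClasses (QuaternionGroup p) |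
            conjClassesPow 3 q.1 = conjClassesPow 3 q.2},
          (Nat.card ↥q.1.carrier : ℚ) * (Nat.card ↥q.2.carrier : ℚ)
            / (Nat.card ↥(conjClassesPow 3 q.1).carrier : ℚ)) = 8 * p) ∧
    (¬ (3 ∣ p) →
      (∑ᶠ q ∈ {q : ConjClasses (QuaternionGroup p) × ConjClasses (QuaternionGroup p) |
            conjClassesPow 3 q.1 = conjClassesPow 3 q.2},
          (Nat.card ↥q.1.carrier : ℚ) * (Nat.card ↥q.2.carrier : ℚ)
            / (Nat.card ↥(conjClassesPow 3 q.1).carrier : ℚ)) = 4 * p) := by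
  have : NeZero p := ⟨hp.ne'⟩
  rw [finsum_conjClassesPow_pairs]
  constructor <;> intro h3
  · have h := QuaternionGroup.sum_card_filter_pow_three_of_dvd h3
    convert! congrArg (Nat.cast : ℕ → ℚ) h <;> push_cast
    · congr!
    · rfl
  · have h := QuaternionGroup.sum_card_filter_pow_three_of_not_dvd h3
    convert! congrArg (Nat.cast : ℕ → ℚ) h <;> push_cast
    · congr!
    · rfl
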